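/- arXiv:2004.09092 — 4 statements merged into one kernel-verified Lean document; each statement's English description precedes it below -/
import Mathlib

section
/- Let p/q and p'/q' be rational numbers in [0,1] with |pq' − p'q| = 1 and q > q'. Then either x_{p/q} < x_{(p+p')/(q+q')} < x_{p'/q'} or x_{p'/q'} < x_{(p+p')/(q+q')} < x_{p/q}; that is, x_{(p+p')/(q+q')} lies strictly between x_{p/q} and x_{p'/q'}. -/
open Filter Real Matrix

noncomputable section

/-- `contQ w n` is the denominator `Q n` of the `n`-th convergent of the
continued fraction `[0; w 1, w 2, …]`. -/
def contQ (w : ℕ → ℕ) : ℕ → ℕ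
  | 0 => 1
  | 1 => w 1
  | n + 2 => w (n + 2) * contQ w (n + 1) + contQ w n

/-- The real number `[0; w 1, w 2, …]` has Lévy constant `ℓ`, i.e. the sequence
`(log Q n)/n` converges to `ℓ`. -/
def HasLevyConstant (w : ℕ → ℕ) (ℓ : ℝ) : Prop :=
  Tendsto (fun n : ℕ => Real.log (contQ w n) / n) atTop (nhds ℓ)

/-- `L` is a (finite) factor of the infinite word `w = w 1 w 2 ⋯`. -/
def IsFactorSeq (w : ℕ → ℕ) (L : List ℕ) : Prop :=
  ∃ i : ℕ, L = (List.range L.length).map fun j => w (i + j + 1)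

/-- The complexity function `p(n, w)`: the number of distinct factors of length `n`. -/
def complexity (w : ℕ → ℕ) (n : ℕ) : ℕ :=
  Set.ncard {L : List ℕ | L.length = n ∧ IsFactorSeq w L}

/-- The mechanical word `s_{θ,ρ}` over `{a,b}` (floor version), indexed from `1`. -/
def mechWord (a b : ℕ) (θ ρ : ℝ) (n : ℕ) : ℕ :=
  if ⌊(n : ℝ) * θ + ρ⌋ - ⌊((n : ℝ) - 1) * θ + ρ⌋ = 0 then a else b

/-- The mechanical word `s'_{θ,ρ}` over `{a,b}` (ceiling version), indexed from `1`. -/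
def mechWord' (a b : ℕ) (θ ρ : ℝ) (n : ℕ) : ℕ :=
  if ⌈(n : ℝ) * θ + ρ⌉ - ⌈((n : ℝ) - 1) * θ + ρ⌉ = 0 then a else b

/-- `w` is a Sturmian word over `{a, b}`: a mechanical word with irrational slope. -/
def IsSturmianWord (a b : ℕ) (w : ℕ → ℕ) : Prop :=
  ∃ θ ρ : ℝ, Irrational θ ∧ θ ∈ Set.Icc (0 : ℝ) 1 ∧ ρ ∈ Set.Ico (0 : ℝ) 1 ∧
    (w = mechWord a b θ ρ ∨ w = mechWord' a b θ ρ)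

/-- The matrix `[[x, 1], [1, 0]]`. -/
def cfMat (x : ℝ) : Matrix (Fin 2) (Fin 2) ℝ := !![x, 1; 1, 0]

/-- `T(b₁, …, b_n)`: the trace of `[[b₁,1],[1,0]] ⋯ [[b_n,1],[1,0]]` for a word
`b₁ ⋯ b_n` over the positive integers.  The trace of the empty word is `2`. -/
def traceWord (L : List ℕ) : ℝ := ((L.map fun c => cfMat (c : ℝ)).prod).trace

/-- The polynomial `𝐓_n(x) = Tr([[x,1],[1,0]]^n)`. -/
def Tpoly (n : ℕ) (x : ℝ) : ℝ := ((cfMat x) ^ n).trace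

/-- The lower Christoffel word `w_{p/q}` over `{a, b}`: the prefix of length `q`
of the mechanical word `s_{p/q, 0}`. -/
def christoffel (a b p q : ℕ) : List ℕ :=
  (List.range q).map fun n => mechWord a b ((p : ℝ) / (q : ℝ)) 0 (n + 1)

/-- `T(w_{p/q})`, the trace attached to the lower Christoffel word of slope `p/q`. -/
def Tw (a b p q : ℕ) : ℝ := traceWord (christoffel a b p q)

/-- The continuant `K(b₁, …, b_n)`: the denominator of `[0; b₁, …, b_n]`. -/
def contList : List ℕ → ℕ
  | [] => 1
  | [x] => x
  | x :: y :: t => x * contList (y :: t) + contList t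

/-- The standard words attached to `d₁, d₂, …` : `sturmM a b d (k+1)` is the word
`M_k`, where `M_{-1} = b`, `M_0 = a` and `M_k = M_{k-1}^{d_k} M_{k-2}`. -/
def sturmM (a b : ℕ) (d : ℕ → ℕ) : ℕ → List ℕ
  | 0 => [b]
  | 1 => [a]
  | k + 2 => (List.replicate (d (k + 1)) (sturmM a b d (k + 1))).flatten ++ sturmM a b d k

/-- Denominators `q_k` of the convergents of `θ = [0; 1 + d₁, d₂, d₃, …]`. -/
def cfQ (d : ℕ → ℕ) : ℕ → ℕ
  | 0 => 1
  | 1 => 1 + d 1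
  | k + 2 => d (k + 2) * cfQ d (k + 1) + cfQ d k

/-- Numerators `p_k` of the convergents of `θ = [0; 1 + d₁, d₂, d₃, …]`. -/
def cfP (d : ℕ → ℕ) : ℕ → ℕ
  | 0 => 0
  | 1 => 1
  | k + 2 => d (k + 2) * cfP d (k + 1) + cfP d k

/-- `w` is ultimately periodic (so that `[0; w 1, w 2, …]` is a quadratic irrational). -/
def UltimatelyPeriodic (w : ℕ → ℕ) : Prop :=
  ∃ r s : ℕ, 0 < s ∧ ∀ n, r < n → w (n + s) = w n

end

section TracePolynomials

lemma trace_mul_mul_self_right (A B : Matrix (Fin 2) (Fin 2) ℝ) :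
    (A * B * B).trace = (A * B).trace * B.trace - B.det * A.trace := by
  simp only [Matrix.trace_fin_two, Matrix.det_fin_two, Matrix.mul_apply, Fin.sum_univ_two]
  ring

lemma trace_mul_mul_self_left (A B : Matrix (Fin 2) (Fin 2) ℝ) :
    (A * (A * B)).trace = A.trace * (A * B).trace - A.det * B.trace := by
  simp only [Matrix.trace_fin_two, Matrix.det_fin_two, Matrix.mul_apply, Fin.sum_univ_two]
  ring

lemma det_cfMat (x : ℝ) : (cfMat x).det = -1 := by
  simp [cfMat, Matrix.det_fin_two]

lemma Tpoly_zero (x : ℝ) : Tpoly 0 x = 2 := by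
  simp [Tpoly]

lemma Tpoly_one (x : ℝ) : Tpoly 1 x = x := by
  simp [Tpoly, cfMat, Matrix.trace_fin_two]

lemma Tpoly_add_add_right (u v : ℕ) (x : ℝ) :
    Tpoly (u + v + v) x = Tpoly (u + v) x * Tpoly v x - (-1) ^ v * Tpoly u x := by
  simp only [Tpoly, pow_add]
  rw [trace_mul_mul_self_right, Matrix.det_pow, det_cfMat]

lemma Tpoly_add_add_left (u v : ℕ) (x : ℝ) :
    Tpoly (u + (u + v)) x = Tpoly u x * Tpoly (u + v) x - (-1) ^ u * Tpoly v x := by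
  simp only [Tpoly, pow_add]
  rw [trace_mul_mul_self_left, Matrix.det_pow, det_cfMat]

lemma Tpoly_add_two (n : ℕ) (x : ℝ) :
    Tpoly (n + 2) x = x * Tpoly (n + 1) x + Tpoly n x := by
  have h := Tpoly_add_add_right n 1 x
  rw [Tpoly_one] at h
  rw [h]
  ring

lemma continuous_Tpoly (n : ℕ) : Continuous (Tpoly n) := by
  induction n using Nat.twoStepInduction with
  | zero => exact continuous_const.congr fun x => (Tpoly_zero x).symm
  | one => exact continuous_id.congr fun x => (Tpoly_one x).symm
  | more n h₀ h₁ =>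
    exact ((continuous_id.mul h₁).add h₀).congr fun x => (Tpoly_add_two n x).symm

lemma Tpoly_pos (n : ℕ) {x : ℝ} (hx : 0 < x) : 0 < Tpoly n x := by
  induction n using Nat.twoStepInduction with
  | zero => simp [Tpoly_zero]
  | one => simpa [Tpoly_one] using hx
  | more n h₀ h₁ => rw [Tpoly_add_two]; positivity

lemma Tpoly_succ_lt (n : ℕ) {x y : ℝ} (hx : 0 < x) (hxy : x < y) :
    Tpoly n x ≤ Tpoly n y ∧ Tpoly (n + 1) x < Tpoly (n + 1) y := by
  induction n with
  | zero => simpa [Tpoly_zero, Tpoly_one] using hxy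
  | succ n ih =>
    refine ⟨ih.2.le, ?_⟩
    rw [Tpoly_add_two, Tpoly_add_two]
    have := mul_lt_mul'' hxy ih.2 hx.le (Tpoly_pos _ hx).le
    linarith [ih.1]

lemma Tpoly_lt {n : ℕ} (hn : 1 ≤ n) {x y : ℝ} (hx : 0 < x) (hxy : x < y) :
    Tpoly n x < Tpoly n y := by
  obtain ⟨k, rfl⟩ := Nat.exists_eq_add_of_le' hn
  exact (Tpoly_succ_lt k hx hxy).2

lemma Tpoly_le (n : ℕ) {x y : ℝ} (hx : 0 < x) (hxy : x ≤ y) : Tpoly n x ≤ Tpoly n y := by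
  rcases hxy.eq_or_lt with rfl | h
  · exact le_rfl
  · exact (Tpoly_succ_lt n hx h).1

lemma eq_of_Tpoly_eq {n : ℕ} (hn : 1 ≤ n) {x y : ℝ} (hx : 0 < x) (hy : 0 < y)
    (h : Tpoly n x = Tpoly n y) : x = y := by
  rcases lt_trichotomy x y with hlt | heq | hlt
  · exact absurd h (Tpoly_lt hn hx hlt).ne
  · exact heq
  · exact absurd h (Tpoly_lt hn hy hlt).ne'

lemma one_le_Tpoly (n : ℕ) {x : ℝ} (hx : 1 ≤ x) : 1 ≤ Tpoly n x := by
  induction n using Nat.twoStepInduction with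
  | zero => simp [Tpoly_zero]
  | one => simpa [Tpoly_one] using hx
  | more n h₀ h₁ => rw [Tpoly_add_two]; nlinarith

lemma two_le_Tpoly {n : ℕ} (hn : Even n) {x : ℝ} (hx : 1 ≤ x) : 2 ≤ Tpoly n x := by
  obtain ⟨k, rfl⟩ := hn.exists_two_nsmul
  rcases k with _ | k
  · simp [Tpoly_zero]
  · rw [smul_eq_mul, mul_add, mul_one, Tpoly_add_two]
    nlinarith [one_le_Tpoly (2 * k) hx, one_le_Tpoly (2 * k + 1) hx]

lemma Tpoly_add_one_le {n k : ℕ} (hn : 1 ≤ n) (hk : 1 ≤ k) {x : ℝ} (hx : 1 ≤ x) :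
    Tpoly n x + 1 ≤ Tpoly (n + k) x := by
  obtain ⟨n, rfl⟩ := Nat.exists_eq_add_of_le' hn
  induction k, hk using Nat.le_induction with
  | base =>
    rw [Tpoly_add_two]
    nlinarith [one_le_Tpoly n hx, one_le_Tpoly (n + 1) hx]
  | succ k hk ih =>
    have h : n + 1 + (k + 1) = (n + k) + 2 := by ring
    have h' : n + k + 1 = n + 1 + k := by ring
    rw [h, Tpoly_add_two, h']
    nlinarith [one_le_Tpoly (n + k) hx, one_le_Tpoly (n + 1 + k) hx]

end TracePolynomials

/-- The Cayley–Hamilton relation for the middle of three hyperbolic traces bounds the displacement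
of the fixed trace by the displacement of the composed one. -/
lemma sub_le_mul_sub_of_trace_relation {l r m n L R M : ℝ} (hl : 2 ≤ l) (hR : 1 ≤ R)
    (hlL : l ≤ L) (hRr : R ≤ r) (hmM : m ≤ M) (hlm : l + 1 ≤ m)
    (hn : n = m * r + l) (hnew : M * R + L = n) (hold : m - l * r ≤ M - L * R) :
    r - R ≤ (n - 1) * (M - m) := by
  have hm : 0 < m := by linarith
  have h₁ : m * (r - R) = R * (M - m) + (L - l) := by linarith
  have h₂ : R * (L - l) - l * (r - R) ≤ M - m := by linarith
  have h₃ : (L - l) * (m * R - l) ≤ (M - m) * (m + l * R) := by nlinarith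
  have hmRl : 1 ≤ m * R - l := by nlinarith
  have h₅ : m + l * R ≤ m * (n - 1) - R := by
    have h₆ : m * m * R ≤ m * m * r := by gcongr
    have h₇ : (l + 1) * R ≤ m * m * R := mul_le_mul_of_nonneg_right (by nlinarith) (by linarith)
    have h₈ : 0 ≤ m * (l - 2) := mul_nonneg hm.le (by linarith)
    rw [hn]
    linarith
  have h₆ : L - l ≤ (M - m) * (m + l * R) := by nlinarith
  have h₇ : (M - m) * (m + l * R) ≤ (M - m) * (m * (n - 1) - R) :=
    mul_le_mul_of_nonneg_left h₅ (by linarith)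
  have : m * (r - R) ≤ m * ((n - 1) * (M - m)) := by nlinarith
  exact le_of_mul_le_mul_left this hm


/-- The estimates satisfied by a Farey pair: `x < y` are the numbers attached to two neighbours with
denominators `u`, `v`, and `m` is the trace attached to their mediant. -/
structure Interlaced (u v : ℕ) (x y m : ℝ) : Prop where
  one_le_left : 1 ≤ u
  one_le_right : 1 ≤ v
  one_le : 1 ≤ x
  lt : x < y
  left_add_one_le : Tpoly u x + 1 ≤ m
  right_add_one_le : Tpoly v y + 1 ≤ m
  grow_left : Tpoly v y - Tpoly v x ≤ m - Tpoly (u + v) x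
  grow_right : Tpoly u y - Tpoly u x ≤ Tpoly (u + v) y - m
  of_odd_left : Odd u → ∀ w, x < w → w < y → Tpoly (u + v) w = m →
    Tpoly v y - Tpoly v w ≤ (m - 1) * (Tpoly u w - Tpoly u x)
  of_odd_right : Odd v → ∀ w, x < w → w < y → Tpoly (u + v) w = m →
    Tpoly u w - Tpoly u x ≤ (m - 1) * (Tpoly v y - Tpoly v w)
  of_even_odd : Even u → Odd v → ∀ w, x ≤ w → w ≤ y →
    m - Tpoly u x * Tpoly v y ≤ Tpoly (u + v) w - Tpoly u w * Tpoly v w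
  of_odd_even : Odd u → Even v → ∀ w, x ≤ w → w ≤ y →
    Tpoly (u + v) w - Tpoly u w * Tpoly v w ≤ m - Tpoly u x * Tpoly v y

namespace Interlaced

variable {u v : ℕ} {x y m : ℝ}

lemma exists_mem_Ioo (h : Interlaced u v x y m) : ∃ w, x < w ∧ w < y ∧ Tpoly (u + v) w = m := by
  have hx : 0 < x := by linarith [h.one_le]
  have hl : Tpoly (u + v) x < m := by
    linarith [h.grow_left, Tpoly_lt h.one_le_right hx h.lt]
  have hr : m < Tpoly (u + v) y := by
    linarith [h.grow_right, Tpoly_lt h.one_le_left hx h.lt]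
  obtain ⟨w, hw, hwm⟩ :=
    intermediate_value_Ioo h.lt.le (continuous_Tpoly (u + v)).continuousOn ⟨hl, hr⟩
  exact ⟨w, hw.1, hw.2, hwm⟩

lemma base {a b : ℝ} (ha : 1 ≤ a) (hab : a < b) : Interlaced 1 1 a b (a * b + 2) where
  one_le_left := le_rfl
  one_le_right := le_rfl
  one_le := ha
  lt := hab
  left_add_one_le := by rw [Tpoly_one]; nlinarith
  right_add_one_le := by rw [Tpoly_one]; nlinarith
  grow_left := by
    rw [Tpoly_add_two 0, zero_add, Tpoly_one, Tpoly_one, Tpoly_zero]; nlinarith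
  grow_right := by
    rw [Tpoly_add_two 0, zero_add, Tpoly_one, Tpoly_one, Tpoly_zero]; nlinarith
  of_odd_left := by
    intro _ w haw hwb hw
    rw [Tpoly_add_two 0, zero_add, Tpoly_one, Tpoly_zero] at hw
    simp only [Tpoly_one]
    have h : a * (b - w) = w * (w - a) := by linarith
    nlinarith [mul_nonneg (sub_nonneg.2 ha) (sub_nonneg.2 hwb.le),
      mul_pos (sub_pos.2 haw) (sub_pos.2 hwb),
      mul_nonneg (sub_nonneg.2 ha) (sub_nonneg.2 haw.le)]
  of_odd_right := by
    intro _ w haw hwb hw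
    rw [Tpoly_add_two 0, zero_add, Tpoly_one, Tpoly_zero] at hw
    simp only [Tpoly_one]
    have h : a * (b - w) = w * (w - a) := by linarith
    nlinarith [mul_nonneg (sub_nonneg.2 ha) (sub_nonneg.2 hwb.le),
      mul_pos (sub_pos.2 haw) (sub_pos.2 hwb)]
  of_even_odd := fun h => by simp at h
  of_odd_even := fun _ h => by simp at h

lemma right (h : Interlaced u v x y m) {w : ℝ} (hxw : x < w) (hwy : w < y)
    (hw : Tpoly (u + v) w = m) :
    Interlaced (u + v) v w y (m * Tpoly v y - (-1) ^ v * Tpoly u x) := by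
  have hx := h.one_le
  have hx₀ : 0 < x := by linarith
  have hw₀ : 0 < w := by linarith
  have hy₀ : 0 < y := by linarith
  have hl₁ : 1 ≤ Tpoly u x := one_le_Tpoly u hx
  have hr₁ : 1 ≤ Tpoly v y := one_le_Tpoly v (by linarith)
  have hlm := h.left_add_one_le
  have hrm := h.right_add_one_le
  have hlw := Tpoly_lt h.one_le_left hx₀ hxw
  have hrw := Tpoly_lt h.one_le_right hw₀ hwy
  have hly := Tpoly_lt h.one_le_left hx₀ h.lt
  have hgr := h.grow_right
  refine ⟨by have := h.one_le_left; omega, h.one_le_right, by linarith, hwy, ?_, ?_, ?_, ?_,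
    ?_, ?_, ?_, ?_⟩
  · rw [hw]
    rcases Nat.even_or_odd v with hv | hv
    · have := two_le_Tpoly hv (x := y) (by linarith)
      rw [hv.neg_one_pow]; nlinarith
    · rw [hv.neg_one_pow]; nlinarith
  · rcases Nat.even_or_odd v with hv | hv
    · have := two_le_Tpoly hv (x := y) (by linarith)
      rw [hv.neg_one_pow]; nlinarith
    · rw [hv.neg_one_pow]; nlinarith
  · rw [Tpoly_add_add_right, hw]
    rcases Nat.even_or_odd v with hv | hv
    · rw [hv.neg_one_pow]; nlinarith
    · have := h.of_odd_right hv w hxw hwy hw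
      rw [hv.neg_one_pow]; linarith
  · rw [Tpoly_add_add_right, hw]
    rcases Nat.even_or_odd v with hv | hv
    · have := two_le_Tpoly hv (x := y) (by linarith)
      rw [hv.neg_one_pow]; nlinarith
    · rw [hv.neg_one_pow]; nlinarith
  · intro huv z hwz hzy hz
    rw [hw]
    rw [Tpoly_add_add_right] at hz
    have hlz := Tpoly_lt h.one_le_left hx₀ (hxw.trans hwz)
    have hrz := Tpoly_lt h.one_le_right (hw₀.trans hwz) hzy
    have hmz := Tpoly_le (u + v) hw₀ hwz.le
    have hRz : 1 ≤ Tpoly v z := one_le_Tpoly v (by linarith)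
    rw [hw] at hmz
    rcases Nat.even_or_odd v with hv | hv
    · rw [hv.neg_one_pow] at hz ⊢
      have h₁ : m * (Tpoly v y - Tpoly v z) ≤ m * (Tpoly (u + v) z - m) := by nlinarith
      have h₂ := le_of_mul_le_mul_left h₁ (by linarith)
      have := two_le_Tpoly hv (x := y) (by linarith)
      have h₃ : 1 ≤ m * Tpoly v y - 1 * Tpoly u x - 1 := by nlinarith
      exact h₂.trans (le_mul_of_one_le_left (by linarith) h₃)
    · have hu : Even u := by
        by_contra hu
        exact Nat.not_odd_iff_even.2 ((Nat.not_even_iff_odd.1 hu).add_odd hv) huv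
      rw [hv.neg_one_pow] at hz ⊢
      exact sub_le_mul_sub_of_trace_relation (two_le_Tpoly hu hx) hRz hlz.le hrz.le hmz hlm
        (by ring) (by linarith) (h.of_even_odd hu hv z (hxw.trans hwz).le hzy.le)
  · intro hv z hwz hzy hz
    rw [hw]
    rw [Tpoly_add_add_right] at hz
    have hlz := Tpoly_lt h.one_le_left hx₀ (hxw.trans hwz)
    have hrz := Tpoly_lt h.one_le_right (hw₀.trans hwz) hzy
    have hmz := Tpoly_le (u + v) hw₀ hwz.le
    have hRz : 1 ≤ Tpoly v z := one_le_Tpoly v (by linarith)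
    rw [hw] at hmz
    rw [hv.neg_one_pow] at hz ⊢
    have h₁ : Tpoly (u + v) z - m ≤ m * (Tpoly v y - Tpoly v z) := by nlinarith
    refine h₁.trans (mul_le_mul_of_nonneg_right ?_ (by linarith))
    nlinarith
  · intro _ hv z hwz _
    rw [Tpoly_add_add_right, hw, hv.neg_one_pow]
    linarith [Tpoly_le u hx₀ (hxw.le.trans hwz)]
  · intro _ hv z hwz _
    rw [Tpoly_add_add_right, hw, hv.neg_one_pow]
    linarith [Tpoly_le u hx₀ (hxw.le.trans hwz)]

lemma left (h : Interlaced u v x y m) {w : ℝ} (hxw : x < w) (hwy : w < y)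
    (hw : Tpoly (u + v) w = m) :
    Interlaced u (u + v) x w (Tpoly u x * m - (-1) ^ u * Tpoly v y) := by
  have hx := h.one_le
  have hx₀ : 0 < x := by linarith
  have hw₀ : 0 < w := by linarith
  have hl₁ : 1 ≤ Tpoly u x := one_le_Tpoly u hx
  have hr₁ : 1 ≤ Tpoly v y := one_le_Tpoly v (by linarith)
  have hlm := h.left_add_one_le
  have hrm := h.right_add_one_le
  have hlw := Tpoly_lt h.one_le_left hx₀ hxw
  have hrw := Tpoly_lt h.one_le_right hw₀ hwy
  have hrx := Tpoly_lt h.one_le_right hx₀ h.lt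
  have hgl := h.grow_left
  refine ⟨h.one_le_left, by have := h.one_le_left; omega, hx, hxw, ?_, ?_, ?_, ?_,
    ?_, ?_, ?_, ?_⟩
  · rcases Nat.even_or_odd u with hu | hu
    · have := two_le_Tpoly hu hx
      rw [hu.neg_one_pow]; nlinarith
    · rw [hu.neg_one_pow]; nlinarith
  · rw [hw]
    rcases Nat.even_or_odd u with hu | hu
    · have := two_le_Tpoly hu hx
      rw [hu.neg_one_pow]; nlinarith
    · rw [hu.neg_one_pow]; nlinarith
  · rw [Tpoly_add_add_left, hw]
    rcases Nat.even_or_odd u with hu | hu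
    · have := two_le_Tpoly hu hx
      rw [hu.neg_one_pow]; nlinarith
    · rw [hu.neg_one_pow]; nlinarith
  · rw [Tpoly_add_add_left, hw]
    rcases Nat.even_or_odd u with hu | hu
    · rw [hu.neg_one_pow]; nlinarith
    · have := h.of_odd_left hu w hxw hwy hw
      rw [hu.neg_one_pow]; linarith
  · intro hu z hxz hzw hz
    rw [hw]
    rw [Tpoly_add_add_left] at hz
    have hlz := Tpoly_lt h.one_le_left hx₀ hxz
    have hrz := Tpoly_lt h.one_le_right (hx₀.trans hxz) (hzw.trans hwy)
    have hmz := Tpoly_le (u + v) (hx₀.trans hxz) hzw.le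
    have hMz : 1 ≤ Tpoly (u + v) z := one_le_Tpoly _ (by linarith)
    rw [hw] at hmz
    rw [hu.neg_one_pow] at hz ⊢
    have h₁ : m - Tpoly (u + v) z ≤ m * (Tpoly u z - Tpoly u x) := by nlinarith
    refine h₁.trans (mul_le_mul_of_nonneg_right ?_ (by linarith))
    nlinarith
  · intro huv z hxz hzw hz
    rw [hw]
    rw [Tpoly_add_add_left] at hz
    have hlz := Tpoly_lt h.one_le_left hx₀ hxz
    have hrz := Tpoly_lt h.one_le_right (hx₀.trans hxz) (hzw.trans hwy)
    have hmz := Tpoly_le (u + v) (hx₀.trans hxz) hzw.le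
    have hz₁ : 1 ≤ z := by linarith
    have hMz : Tpoly u z + 1 ≤ Tpoly (u + v) z :=
      Tpoly_add_one_le h.one_le_left h.one_le_right hz₁
    rw [hw] at hmz
    rcases Nat.even_or_odd u with hu | hu
    · rw [hu.neg_one_pow] at hz ⊢
      have h₁ : Tpoly (u + v) z * (Tpoly u z - Tpoly u x) ≤
          Tpoly (u + v) z * (m - Tpoly (u + v) z) := by nlinarith
      have h₂ := le_of_mul_le_mul_left h₁ (by linarith)
      have := two_le_Tpoly hu hx
      have h₃ : 1 ≤ Tpoly u x * m - 1 * Tpoly v y - 1 := by nlinarith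
      exact h₂.trans (le_mul_of_one_le_left (by linarith) h₃)
    · have hv : Even v := by
        by_contra hv
        exact Nat.not_odd_iff_even.2 (hu.add_odd (Nat.not_even_iff_odd.1 hv)) huv
      have hvz : Tpoly v z + 1 ≤ Tpoly (u + v) z := by
        rw [add_comm u v]
        exact Tpoly_add_one_le h.one_le_right h.one_le_left hz₁
      rw [hu.neg_one_pow] at hz ⊢
      exact sub_le_mul_sub_of_trace_relation (two_le_Tpoly hv hz₁) hl₁ hrz.le hlz.le hmz hvz
        (by linarith) (by ring)
        (by linarith [h.of_odd_even hu hv z hxz.le (hzw.trans hwy).le])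
  · intro hu _ z hxz hzw
    rw [Tpoly_add_add_left, hw, hu.neg_one_pow]
    linarith [Tpoly_le v (hx₀.trans_le hxz) (hzw.trans hwy.le)]
  · intro hu _ z hxz hzw
    rw [Tpoly_add_add_left, hw, hu.neg_one_pow]
    linarith [Tpoly_le v (hx₀.trans_le hxz) (hzw.trans hwy.le)]

end Interlaced
section ChristoffelWords

lemma floor_natCast_mul_div (n p q : ℕ) : ⌊(n : ℝ) * ((p : ℝ) / q) + 0⌋ = ((n * p / q : ℕ) : ℤ) := by
  rw [add_zero, ← mul_div_assoc, ← Nat.cast_mul, Int.floor_div_natCast, Int.floor_natCast]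
  rfl

lemma mechWord_succ_eq (a b p q n : ℕ) :
    mechWord a b ((p : ℝ) / q) 0 (n + 1) = if (n + 1) * p / q = n * p / q then a else b := by
  unfold mechWord
  have h : ((n + 1 : ℕ) : ℝ) - 1 = (n : ℝ) := by push_cast; ring
  rw [h, floor_natCast_mul_div, floor_natCast_mul_div]
  simp only [sub_eq_zero, Nat.cast_inj]

lemma mediant_mul_div_of_le {p q p' q' n : ℕ} (hq' : 1 ≤ q') (hdet : p' * q = p * q' + 1)
    (hn : n ≤ q) : n * (p + p') / (q + q') = n * p / q := by
  rcases Nat.eq_zero_or_pos q with rfl | hq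
  · simp [Nat.le_zero.1 hn]
  set k := n * p / q with hk
  have h₁ : k * q ≤ n * p := Nat.div_mul_le_self _ _
  have h₂ : n * p + 1 ≤ (k + 1) * q := by
    have := Nat.lt_mul_div_succ (n * p) hq
    rw [← hk] at this
    linarith
  rw [Nat.div_eq_iff (by omega)]
  have h₃ : k * q' ≤ n * p' := by
    refine Nat.le_of_mul_le_mul_right (c := q) ?_ hq
    nlinarith
  have h₄ : n * (p + p') < (k + 1) * (q + q') := by
    refine Nat.lt_of_mul_lt_mul_right (a := q) ?_
    nlinarith
  constructor
  · nlinarith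
  · have : (k + 1) * (q + q') = k * (q + q') + (q + q') := by ring
    omega

lemma mediant_mul_div_add {p q p' q' j : ℕ} (hq : 1 ≤ q) (hq' : 1 ≤ q') (hdet : p' * q = p * q' + 1)
    (hj : j ≤ q') : (q + j) * (p + p') / (q + q') = p + j * p' / q' := by
  set k := j * p' / q' with hk
  have h₁ : k * q' ≤ j * p' := Nat.div_mul_le_self _ _
  have h₂ : j * p' + 1 ≤ (k + 1) * q' := by
    have := Nat.lt_mul_div_succ (j * p') hq'
    rw [← hk] at this
    linarith
  have h₀ : (q + j) * (p + p') = p * (q + q') + (1 + j * (p + p')) := by nlinarith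
  rw [h₀, Nat.mul_comm p, Nat.mul_add_div (by omega)]
  congr 1
  rw [Nat.div_eq_iff (by omega)]
  have h₃ : k * (q + q') ≤ 1 + j * (p + p') := by
    refine Nat.le_of_mul_le_mul_right (c := q') ?_ hq'
    nlinarith
  have h₄ : 1 + j * (p + p') < (k + 1) * (q + q') := by
    refine Nat.lt_of_mul_lt_mul_right (a := q') ?_
    nlinarith
  constructor
  · exact h₃
  · have : (k + 1) * (q + q') = k * (q + q') + (q + q') := by ring
    omega

/-- The standard factorization of the lower Christoffel word of a mediant. -/
lemma christoffel_mediant (a b : ℕ) {p q p' q' : ℕ} (hq : 1 ≤ q) (hq' : 1 ≤ q')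
    (hdet : p' * q = p * q' + 1) :
    christoffel a b (p + p') (q + q') = christoffel a b p q ++ christoffel a b p' q' := by
  simp only [christoffel, mechWord_succ_eq]
  rw [List.range_add, List.map_append, List.map_map]
  congr 1
  · refine List.map_congr_left fun n hn => ?_
    have hn := List.mem_range.1 hn
    rw [mediant_mul_div_of_le hq' hdet (by omega), mediant_mul_div_of_le hq' hdet hn.le]
  · refine List.map_congr_left fun j hj => ?_
    have hj := List.mem_range.1 hj
    simp only [Function.comp_apply]
    rw [add_assoc, mediant_mul_div_add hq hq' hdet (by omega), mediant_mul_div_add hq hq' hdet hj.le]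
    simp

/-- The product of continued fraction matrices along the lower Christoffel word of slope `p/q`. -/
noncomputable def christoffelMat (a b p q : ℕ) : Matrix (Fin 2) (Fin 2) ℝ :=
  ((christoffel a b p q).map fun c : ℕ => cfMat (c : ℝ)).prod

lemma trace_christoffelMat (a b p q : ℕ) : (christoffelMat a b p q).trace = Tw a b p q := by
  have h (L : List ℕ) : (do let c ← L; pure (c : ℝ)) = L.map fun c : ℕ => (c : ℝ) := by
    exact List.flatMap_pure_eq_map (fun c : ℕ => (c : ℝ)) L
  rw [christoffelMat, Tw, traceWord, h, List.map_map]
  rfl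

lemma det_christoffelMat (a b p q : ℕ) : (christoffelMat a b p q).det = (-1) ^ q := by
  have h (L : List ℕ) : ((L.map fun c : ℕ => cfMat (c : ℝ)).prod).det = (-1) ^ L.length := by
    induction L with
    | nil => simp
    | cons c L ih => simp [ih, det_cfMat, pow_succ]
  rw [christoffelMat, h, christoffel, List.length_map, List.length_range]

lemma christoffelMat_mediant (a b : ℕ) {p q p' q' : ℕ} (hq : 1 ≤ q) (hq' : 1 ≤ q')
    (hdet : p' * q = p * q' + 1) :
    christoffelMat a b (p + p') (q + q') = christoffelMat a b p q * christoffelMat a b p' q' := by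
  simp only [christoffelMat]
  rw [christoffel_mediant a b hq hq' hdet, List.map_append, List.prod_append]

lemma Tw_mediant_add_right (a b : ℕ) {p q p' q' : ℕ} (hq : 1 ≤ q) (hq' : 1 ≤ q')
    (hdet : p' * q = p * q' + 1) :
    Tw a b (p + p' + p') (q + q' + q') =
      Tw a b (p + p') (q + q') * Tw a b p' q' - (-1) ^ q' * Tw a b p q := by
  simp only [← trace_christoffelMat]
  rw [christoffelMat_mediant a b (by omega) hq' (by linarith),
    christoffelMat_mediant a b hq hq' hdet, trace_mul_mul_self_right, det_christoffelMat]

lemma Tw_mediant_add_left (a b : ℕ) {p q p' q' : ℕ} (hq : 1 ≤ q) (hq' : 1 ≤ q')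
    (hdet : p' * q = p * q' + 1) :
    Tw a b (p + (p + p')) (q + (q + q')) =
      Tw a b p q * Tw a b (p + p') (q + q') - (-1) ^ q * Tw a b p' q' := by
  simp only [← trace_christoffelMat]
  rw [christoffelMat_mediant a b hq (by omega) (by linarith),
    christoffelMat_mediant a b hq hq' hdet, trace_mul_mul_self_left, det_christoffelMat]

lemma christoffel_zero_one (a b : ℕ) : christoffel a b 0 1 = [a] := by
  simp [christoffel, mechWord]

lemma christoffel_one_one (a b : ℕ) : christoffel a b 1 1 = [b] := by
  simp [christoffel, mechWord]

lemma Tw_zero_one (a b : ℕ) : Tw a b 0 1 = a := by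
  rw [← trace_christoffelMat]
  simp [christoffelMat, christoffel_zero_one, cfMat, Matrix.trace_fin_two]

lemma Tw_one_one (a b : ℕ) : Tw a b 1 1 = b := by
  rw [← trace_christoffelMat]
  simp [christoffelMat, christoffel_one_one, cfMat, Matrix.trace_fin_two]

lemma Tw_one_two (a b : ℕ) : Tw a b (0 + 1) (1 + 1) = a * b + 2 := by
  rw [← trace_christoffelMat, christoffelMat_mediant a b le_rfl le_rfl rfl]
  simp [christoffelMat, christoffel_zero_one, christoffel_one_one, cfMat, Matrix.trace_fin_two]
  ring

end ChristoffelWords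

/-- Every Farey pair of slopes is interlaced. -/
lemma exists_interlaced {a b : ℕ} (ha : 1 ≤ a) (hab : a < b) :
    ∀ s p q p' q' : ℕ, q + q' = s → 1 ≤ q → 1 ≤ q' → p ≤ q → p' ≤ q' → p' * q = p * q' + 1 →
      ∃ x y : ℝ, Tpoly q x = Tw a b p q ∧ Tpoly q' y = Tw a b p' q' ∧
        Interlaced q q' x y (Tw a b (p + p') (q + q')) := by
  intro s
  induction s using Nat.strong_induction_on with
  | _ s ih =>
  intro p q p' q' hs hq hq' hp hp' hdet
  rcases lt_trichotomy q q' with hlt | heq | hlt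
  · obtain ⟨d, rfl⟩ := Nat.exists_eq_add_of_le hlt.le
    have hpp' : p ≤ p' := by
      by_contra! hc
      nlinarith
    obtain ⟨e, rfl⟩ := Nat.exists_eq_add_of_le hpp'
    have hdet' : e * q = p * d + 1 := by nlinarith
    have hed : e ≤ d := by
      by_contra! hc
      nlinarith
    obtain ⟨x, y, hx, hy, h⟩ := ih (q + d) (by omega) p q e d rfl hq (by omega) hp hed hdet'
    obtain ⟨w, hxw, hwy, hw⟩ := h.exists_mem_Ioo
    refine ⟨x, w, hx, hw, ?_⟩
    rw [Tw_mediant_add_left a b hq (by omega) hdet', ← hx, ← hy]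
    exact h.left hxw hwy hw
  · subst heq
    obtain rfl : q = 1 := by
      have h : q ∣ 1 := (Nat.dvd_add_right (Dvd.intro_left p rfl)).1 (hdet ▸ Dvd.intro_left p' rfl)
      exact Nat.dvd_one.1 h
    obtain ⟨rfl, rfl⟩ : p = 0 ∧ p' = 1 := by omega
    refine ⟨a, b, ?_, ?_, ?_⟩
    · rw [Tpoly_one, Tw_zero_one]
    · rw [Tpoly_one, Tw_one_one]
    · rw [Tw_one_two]
      exact Interlaced.base (by exact_mod_cast ha) (by exact_mod_cast hab)
  · obtain ⟨d, rfl⟩ := Nat.exists_eq_add_of_le' hlt.le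
    have hpp' : p' ≤ p := by
      by_contra! hc
      nlinarith
    obtain ⟨e, rfl⟩ := Nat.exists_eq_add_of_le' hpp'
    have hdet' : p' * d = e * q' + 1 := by nlinarith
    have hed : e ≤ d := by
      by_contra! hc
      nlinarith
    obtain ⟨x, y, hx, hy, h⟩ := ih (d + q') (by omega) e d p' q' rfl (by omega) hq' hed hp' hdet'
    obtain ⟨w, hxw, hwy, hw⟩ := h.exists_mem_Ioo
    refine ⟨w, y, hw, hy, ?_⟩
    rw [Tw_mediant_add_right a b (by omega) hq' hdet', ← hx, ← hy]
    exact h.right hxw hwy hw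

lemma strict_between_of_farey {a b : ℕ} (ha : 1 ≤ a) (hab : a < b) {p q p' q' : ℕ}
    (hq : 1 ≤ q) (hq' : 1 ≤ q') (hp : p ≤ q) (hp' : p' ≤ q') (hdet : p' * q = p * q' + 1)
    {x y w : ℝ} (hx : 0 < x) (hxT : Tpoly q x = Tw a b p q)
    (hy : 0 < y) (hyT : Tpoly q' y = Tw a b p' q')
    (hw : 0 < w) (hwT : Tpoly (q + q') w = Tw a b (p + p') (q + q')) :
    x < w ∧ w < y := by
  obtain ⟨x', y', hx', hy', h⟩ := exists_interlaced ha hab _ p q p' q' rfl hq hq' hp hp' hdet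
  obtain ⟨w', hxw, hwy, hw'⟩ := h.exists_mem_Ioo
  have hx₀ : 0 < x' := by linarith [h.one_le]
  obtain rfl := eq_of_Tpoly_eq hq hx hx₀ (hxT.trans hx'.symm)
  obtain rfl := eq_of_Tpoly_eq hq' hy (by linarith) (hyT.trans hy'.symm)
  obtain rfl := eq_of_Tpoly_eq (by omega) hw (by linarith) (hwT.trans hw'.symm)
  exact ⟨hxw, hwy⟩

/-- Proposition `prop:monotone`. For Farey neighbours `p/q`, `p'/q'`
in `[0,1]` with `q > q'`, the number `x_{(p+p')/(q+q')}` lies strictly between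
`x_{p/q}` and `x_{p'/q'}`. -/
theorem stmt13 (a b : ℕ) (ha : 1 ≤ a) (hab : a < b)
    (p q p' q' : ℕ) (hq' : 1 ≤ q') (hqq' : q' < q) (hp : p ≤ q) (hp' : p' ≤ q')
    (hdet : (p : ℤ) * q' - p' * q = 1 ∨ (p : ℤ) * q' - p' * q = -1)
    (x₁ x₂ x₃ : ℝ)
    (hx₁ : 0 < x₁) (hx₁T : Tpoly q x₁ = Tw a b p q)
    (hx₂ : 0 < x₂) (hx₂T : Tpoly q' x₂ = Tw a b p' q')
    (hx₃ : 0 < x₃) (hx₃T : Tpoly (q + q') x₃ = Tw a b (p + p') (q + q')) :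
    (x₁ < x₃ ∧ x₃ < x₂) ∨ (x₂ < x₃ ∧ x₃ < x₁) := by
  rcases hdet with hdet | hdet
  · right
    rw [add_comm q q'] at hx₃T
    rw [add_comm p p'] at hx₃T
    exact strict_between_of_farey ha hab hq' (by omega) hp' hp (by zify; linarith)
      hx₂ hx₂T hx₁ hx₁T hx₃ hx₃T
  · left
    exact strict_between_of_farey ha hab (by omega) hq' hp hp' (by zify; linarith)
      hx₁ hx₁T hx₂ hx₂T hx₃ hx₃T
end

section
/- Let a, b be integers with 1 ≤ a < b and let θ ∈ (0,1) be irrational with convergents p_k/q_k. Then L(α_θ) = lim_{k→∞} L(α_{p_k/q_k}), where α_θ = [0; s_{θ,0}] and α_{p_k/q_k} = [0; s_{p_k/q_k,0}]. -/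
open Filter Real Matrix

/-- Continuants are submultiplicative up to a factor `2` and supermultiplicative. -/
lemma contQ_add_bounds (w : ℕ → ℕ) (hw : ∀ n, 1 ≤ w n) (m n : ℕ) :
    contQ w m * contQ (fun i => w (m + i)) n ≤ contQ w (m + n) ∧
      contQ w (m + n) ≤ 2 * (contQ w m * contQ (fun i => w (m + i)) n) := by
  have mono : ∀ k, contQ w k ≤ contQ w (k + 1) := by
    intro k
    cases k with
    | zero => simpa [contQ] using hw 1
    | succ k =>
      simp only [contQ]
      nlinarith [hw (k + 2), Nat.zero_le (contQ w (k + 1))]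
  induction n using Nat.twoStepInduction with
  | zero => simp [contQ]; omega
  | one =>
    cases m with
    | zero => simp [contQ]; omega
    | succ m =>
      have h1 := mono m
      have h2 := hw (m + 2)
      simp only [contQ, show m + 1 + 1 = m + 2 from rfl]
      constructor <;> nlinarith
  | more n ih1 ih2 =>
    have e : contQ w (m + (n + 2)) =
        w (m + (n + 2)) * contQ w (m + (n + 1)) + contQ w (m + n) := rfl
    rw [e]
    simp only [contQ.eq_3 (fun i => w (m + i))]
    constructor
    · nlinarith [Nat.mul_le_mul_left (w (m + (n + 2))) ih2.1, ih1.1]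
    · nlinarith [Nat.mul_le_mul_left (w (m + (n + 2))) ih2.2, ih1.2]

lemma contQ_pos (w : ℕ → ℕ) (hw : ∀ n, 1 ≤ w n) (n : ℕ) : 0 < contQ w n := by
  induction n using Nat.twoStepInduction with
  | zero => simp [contQ]
  | one => exact hw 1
  | more n ih1 ih2 => simp only [contQ]; positivity

lemma contQ_congr {w v : ℕ → ℕ} (n : ℕ) (h : ∀ i, 1 ≤ i → i ≤ n → w i = v i) :
    contQ w n = contQ v n := by
  induction n using Nat.twoStepInduction with
  | zero => rfl
  | one => exact h 1 le_rfl le_rfl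
  | more n ih1 ih2 =>
    simp only [contQ]
    rw [ih1 fun i h1 h2 => h i h1 (by omega), ih2 fun i h1 h2 => h i h1 (by omega),
      h (n + 2) (by omega) le_rfl]

lemma contQ_mul_bounds (w : ℕ → ℕ) (hw : ∀ n, 1 ≤ w n) (q : ℕ)
    (hper : ∀ n, 1 ≤ n → w (q + n) = w n) (j : ℕ) :
    contQ w q ^ j ≤ contQ w (q * j) ∧ contQ w (q * j) ≤ (2 * contQ w q) ^ j := by
  induction j with
  | zero => simp [contQ]
  | succ j ih =>
    have h := contQ_add_bounds w hw q (q * j)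
    rw [contQ_congr (v := w) (q * j) fun i hi _ => hper i hi] at h
    rw [show q * (j + 1) = q + q * j by ring, pow_succ', pow_succ']
    constructor
    · exact (Nat.mul_le_mul_left _ ih.1).trans h.1
    · refine h.2.trans ?_
      rw [← mul_assoc]
      exact Nat.mul_le_mul_left _ ih.2

/-- The Lévy constant of a purely periodic word is approximated by one period. -/
lemma HasLevyConstant.abs_sub_le_of_periodic {w : ℕ → ℕ} {ℓ : ℝ} (h : HasLevyConstant w ℓ)
    (hw : ∀ n, 1 ≤ w n) {q : ℕ} (hq : 0 < q) (hper : ∀ n, 1 ≤ n → w (q + n) = w n) :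
    |ℓ - log (contQ w q) / q| ≤ log 2 / q := by
  have hsub : Tendsto (fun j : ℕ => log (contQ w (q * j)) / (q * j : ℕ)) atTop (nhds ℓ) :=
    h.comp (tendsto_id.const_mul_atTop' hq)
  have habs := (hsub.sub_const (log (contQ w q) / q)).abs
  refine le_of_tendsto habs ?_
  filter_upwards [eventually_ge_atTop 1] with j hj
  have hQ : (0 : ℝ) < contQ w q := by exact_mod_cast contQ_pos w hw q
  have hQj : (0 : ℝ) < contQ w (q * j) := by exact_mod_cast contQ_pos w hw (q * j)
  obtain ⟨h1, h2⟩ := contQ_mul_bounds w hw q hper j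
  have l1 : (j : ℝ) * log (contQ w q) ≤ log (contQ w (q * j)) := by
    rw [← log_pow]
    exact log_le_log (by positivity) (by exact_mod_cast h1)
  have l2 : log (contQ w (q * j)) ≤ j * (log 2 + log (contQ w q)) := by
    rw [← log_mul two_ne_zero hQ.ne', ← log_pow]
    exact log_le_log hQj (by exact_mod_cast h2)
  have hq' : (0 : ℝ) < q := by exact_mod_cast hq
  have hj' : (0 : ℝ) < j := by exact_mod_cast hj
  have e : log (contQ w (q * j)) / (q * j : ℕ) - log (contQ w q) / q =
      (log (contQ w (q * j)) - j * log (contQ w q)) / (q * j) := by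
    push_cast
    field_simp
  rw [e, abs_of_nonneg (div_nonneg (by linarith) (by positivity)),
    div_le_div_iff₀ (by positivity) hq']
  nlinarith

/-- Changing the last letter of a word over `{1, …, b}` changes the logarithm of its continuant
by at most `log (b + 1)`. -/
lemma log_contQ_sub_le (w v : ℕ → ℕ) (hw : ∀ n, 1 ≤ w n) (hv : ∀ n, 1 ≤ v n) (b q : ℕ)
    (hwb : ∀ n, w n ≤ b) (h : ∀ i, 1 ≤ i → i < q → w i = v i) :
    log (contQ w q) - log (contQ v q) ≤ log (b + 1) := by
  have hle : contQ w q ≤ (b + 1) * contQ v q := by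
    match q with
    | 0 => simp [contQ]
    | 1 =>
      simp only [contQ]
      nlinarith [hwb 1, hv 1]
    | n + 2 =>
      simp only [contQ]
      rw [contQ_congr (v := v) (n + 1) fun i h1 h2 => h i h1 (by omega),
        contQ_congr (v := v) n fun i h1 h2 => h i h1 (by omega)]
      have h1 := Nat.mul_le_mul_right (contQ v (n + 1)) (hwb (n + 2))
      have h2 := Nat.mul_le_mul_right (contQ v (n + 1)) (hv (n + 2))
      nlinarith [Nat.mul_le_mul_left b h2]
  have h1 : (0 : ℝ) < contQ w q := by exact_mod_cast contQ_pos w hw q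
  have h2 : (0 : ℝ) < contQ v q := by exact_mod_cast contQ_pos v hv q
  rw [sub_le_iff_le_add, ← log_mul (by positivity) h2.ne']
  exact log_le_log h1 (by exact_mod_cast hle)

lemma abs_log_contQ_sub_le {w v : ℕ → ℕ} {b : ℕ} (q : ℕ) (hw : ∀ n, 1 ≤ w n) (hv : ∀ n, 1 ≤ v n)
    (hwb : ∀ n, w n ≤ b) (hvb : ∀ n, v n ≤ b) (h : ∀ i, 1 ≤ i → i < q → w i = v i) :
    |log (contQ w q) - log (contQ v q)| ≤ log (b + 1) := by
  rw [abs_le]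
  have h1 := log_contQ_sub_le w v hw hv b q hwb h
  have h2 := log_contQ_sub_le v w hv hw b q hvb fun i hi hi' => (h i hi hi').symm
  constructor <;> linarith

lemma mechWord_rat_periodic (a b : ℕ) (r : ℚ) (n : ℕ) :
    mechWord a b r 0 (r.den + n) = mechWord a b r 0 n := by
  have hden : (r.den : ℝ) * r = r.num := by exact_mod_cast Rat.den_mul_eq_num r
  have h1 : ((r.den + n : ℕ) : ℝ) * r + 0 = n * r + 0 + r.num := by
    push_cast
    rw [← hden]
    ring
  have h2 : (((r.den + n : ℕ) : ℝ) - 1) * r + 0 = (n - 1) * r + 0 + r.num := by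
    push_cast
    rw [← hden]
    ring
  simp only [mechWord, h1, h2, Int.floor_add_intCast, add_sub_add_right_eq_sub]

lemma floor_mul_eq_of_abs_sub_le {θ : ℝ} {r : ℚ} (h : |θ - r| ≤ 1 / (r.den : ℝ) ^ 2) {n : ℕ}
    (hn : n < r.den) : ⌊(n : ℝ) * θ⌋ = ⌊(n : ℝ) * r⌋ := by
  rcases Nat.eq_zero_or_pos n with rfl | hn0
  · simp
  have hq : (0 : ℝ) < r.den := by exact_mod_cast r.den_pos
  have hden : (r.den : ℝ) * r = r.num := by exact_mod_cast Rat.den_mul_eq_num r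
  have hlow := Int.floor_le ((n : ℝ) * r)
  have hupp := Int.lt_floor_add_one ((n : ℝ) * r)
  set f := ⌊(n : ℝ) * r⌋
  have hd : ((n * r.num - f * r.den : ℤ) : ℝ) = (n * r - f) * r.den := by
    push_cast
    rw [← hden]
    ring
  have hne : (n * r.num - f * r.den : ℤ) ≠ 0 := by
    intro h0
    have hdvd : (r.den : ℤ) ∣ n * r.num := ⟨f, by linarith⟩
    have hcop : IsCoprime (r.den : ℤ) r.num := (Rat.isCoprime_num_den r).symm
    have h1 := Int.natCast_dvd_natCast.1 (hcop.dvd_of_dvd_mul_right hdvd)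
    exact absurd (Nat.le_of_dvd hn0 h1) (by omega)
  have hnn : (0 : ℤ) ≤ n * r.num - f * r.den := by
    have : (0 : ℝ) ≤ ((n * r.num - f * r.den : ℤ) : ℝ) := by
      rw [hd]
      exact mul_nonneg (by linarith) hq.le
    exact_mod_cast this
  have hlt : (n * r.num - f * r.den : ℤ) < r.den := by
    have : ((n * r.num - f * r.den : ℤ) : ℝ) < r.den := by
      rw [hd]
      nlinarith
    exact_mod_cast this
  have g1 : (1 : ℝ) ≤ (n * r - f) * r.den := by
    rw [← hd]
    exact_mod_cast (by omega : (1 : ℤ) ≤ n * r.num - f * r.den)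
  have g2 : ((n : ℝ) * r - f) * r.den + 1 ≤ r.den := by
    rw [← hd]
    exact_mod_cast (by omega : (n * r.num - f * r.den : ℤ) + 1 ≤ r.den)
  have hsmall : |(n : ℝ) * (θ - r) * r.den| < 1 := by
    rw [abs_mul, abs_mul, Nat.abs_cast, Nat.abs_cast]
    rw [le_div_iff₀ (by positivity)] at h
    have hn' : (n : ℝ) < r.den := by exact_mod_cast hn
    rcases (abs_nonneg (θ - r)).eq_or_lt' with h0 | h0
    · rw [h0]
      simp
    · have : n * |θ - r| * r.den < r.den * |θ - r| * r.den := by gcongr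
      nlinarith
  rw [abs_lt] at hsmall
  rw [Int.floor_eq_iff]
  constructor
  · have : 0 ≤ (n * θ - f) * r.den := by linarith
    linarith [nonneg_of_mul_nonneg_left this hq]
  · have : (n * θ - f) * r.den < 1 * r.den := by linarith
    linarith [lt_of_mul_lt_mul_right this hq.le]

lemma mechWord_eq_of_abs_sub_le (a b : ℕ) {θ : ℝ} {r : ℚ}
    (h : |θ - r| ≤ 1 / (r.den : ℝ) ^ 2) {n : ℕ} (hn : 1 ≤ n) (hn' : n < r.den) :
    mechWord a b θ 0 n = mechWord a b r 0 n := by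
  obtain ⟨m, rfl⟩ := Nat.exists_eq_add_of_le' hn
  have e : ((m + 1 : ℕ) : ℝ) - 1 = m := by push_cast; ring
  simp only [mechWord, e, add_zero]
  rw [floor_mul_eq_of_abs_sub_le h hn', floor_mul_eq_of_abs_sub_le h (by omega : m < r.den)]

lemma one_le_mechWord {a b : ℕ} (ha : 1 ≤ a) (hab : a < b) (θ ρ : ℝ) (n : ℕ) :
    1 ≤ mechWord a b θ ρ n := by
  unfold mechWord
  split_ifs <;> omega

lemma mechWord_le {a b : ℕ} (hab : a < b) (θ ρ : ℝ) (n : ℕ) : mechWord a b θ ρ n ≤ b := by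
  unfold mechWord
  split_ifs <;> omega

lemma exists_int_contsAux_eq (v : ℝ) (n : ℕ) :
    ∃ x y : ℤ, (GenContFract.of v).contsAux n = ⟨(x : ℝ), (y : ℝ)⟩ := by
  induction n using Nat.twoStepInduction with
  | zero => exact ⟨1, 0, by simp [GenContFract.contsAux]⟩
  | one => exact ⟨⌊v⌋, 1, by simp [GenContFract.contsAux]⟩
  | more n ih1 ih2 =>
    obtain ⟨x, y, hxy⟩ := ih1
    obtain ⟨x', y', hxy'⟩ := ih2
    rcases hs : (GenContFract.of v).s.get? n with _ | gp
    · refine ⟨x', y', ?_⟩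
      rw [← hxy']
      exact GenContFract.contsAux_stable_step_of_terminated hs
    · obtain ⟨ha, z, hz⟩ := GenContFract.of_partNum_eq_one_and_exists_int_partDen_eq hs
      refine ⟨z * x' + x, z * y' + y, ?_⟩
      rw [GenContFract.contsAux_recurrence hs hxy hxy', ha, hz]
      simp

/-- A convergent of an irrational `θ`, in lowest terms, approximates `θ` to within the inverse
square of its denominator. -/
lemma abs_sub_convergent_le {θ : ℝ} (hθ : Irrational θ) (k : ℕ) :
    |θ - (θ.convergent k : ℝ)| ≤ 1 / ((θ.convergent k).den : ℝ) ^ 2 := by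
  have hnt : ∀ n, ¬ (GenContFract.of θ).TerminatedAt n := by
    intro n hn
    obtain ⟨q, hq⟩ := (GenContFract.terminates_iff_rat θ).1 ⟨n, hn⟩
    exact hθ ⟨q, hq.symm⟩
  have habs := GenContFract.abs_sub_convs_le (hnt k)
  have hmono : (GenContFract.of θ).dens k ≤ (GenContFract.of θ).dens (k + 1) :=
    GenContFract.of_den_mono
  have hfib : ((Nat.fib (k + 1) : ℕ) : ℝ) ≤ (GenContFract.of θ).dens k :=
    GenContFract.succ_nth_fib_le_of_nth_den (Or.inr (hnt _))
  have hpos : (0 : ℝ) < (GenContFract.of θ).dens k :=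
    lt_of_lt_of_le (by exact_mod_cast Nat.fib_pos.2 k.succ_pos) hfib
  obtain ⟨x, y, hxy⟩ := exists_int_contsAux_eq θ (k + 1)
  have hden : (GenContFract.of θ).dens k = y := by
    rw [GenContFract.den_eq_conts_b, GenContFract.nth_cont_eq_succ_nth_contAux, hxy]
  have hnum : (GenContFract.of θ).nums k = x := by
    rw [GenContFract.num_eq_conts_a, GenContFract.nth_cont_eq_succ_nth_contAux, hxy]
  have hy : 0 < y := by
    rw [hden] at hpos
    exact_mod_cast hpos
  have hr : θ.convergent k = (x : ℚ) / y := by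
    have h := Real.convs_eq_convergent θ k
    rw [GenContFract.conv_eq_num_div_den, hden, hnum] at h
    exact_mod_cast h.symm
  have hle : ((θ.convergent k).den : ℝ) ≤ (GenContFract.of θ).dens k := by
    rw [hden, hr]
    exact_mod_cast Int.le_of_dvd hy (Rat.den_dvd x y)
  rw [Real.convs_eq_convergent] at habs
  refine habs.trans ?_
  have hd : (0 : ℝ) < (θ.convergent k).den := by exact_mod_cast (θ.convergent k).den_pos
  apply one_div_le_one_div_of_le (by positivity)
  rw [sq]
  exact mul_le_mul hle (hle.trans hmono) hd.le hpos.le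

lemma tendsto_den_convergent {θ : ℝ} (hθ : Irrational θ) :
    Tendsto (fun k => (θ.convergent k).den) atTop atTop := by
  rw [tendsto_atTop]
  intro N
  have hev : ∀ᶠ ε : ℝ in nhdsWithin 0 (Set.Ioi 0), ∀ r : ℚ, r.den ≤ N → ε ≤ dist θ r :=
    nhdsWithin_le_nhds (hθ.eventually_forall_le_dist_cast_rat_of_den_le N)
  obtain ⟨ε, hε, hε0⟩ := (hev.and self_mem_nhdsWithin).exists
  have hconv := GenContFract.of_convergence θ
  filter_upwards [hconv.eventually (Metric.ball_mem_nhds θ hε0)] with k hk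
  by_contra! hlt
  rw [Real.convs_eq_convergent, dist_comm] at hk
  exact absurd (hε _ hlt.le) (not_le.2 hk)

/-- Lemma `lem:cont`. For an irrational slope `θ ∈ (0,1)` with
principal convergents `p_k / q_k`, one has `𝓛(α_θ) = lim_k 𝓛(α_{p_k/q_k})`, where
`α_θ = [0; s_{θ,0}]`. -/
theorem stmt15 (a b : ℕ) (ha : 1 ≤ a) (hab : a < b)
    (θ : ℝ) (hθ : Irrational θ) (hθI : θ ∈ Set.Ioo (0 : ℝ) 1)
    (ℓ : ℝ) (hℓ : HasLevyConstant (mechWord a b θ 0) ℓ)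
    (ℓs : ℕ → ℝ)
    (hℓs : ∀ k, HasLevyConstant (mechWord a b ((GenContFract.of θ).convs k) 0) (ℓs k)) :
    Tendsto ℓs atTop (nhds ℓ) := by
  have hq := tendsto_den_convergent hθ
  have hmain := hℓ.comp hq
  have herr : Tendsto (fun k => (log 2 + log (b + 1)) / ((θ.convergent k).den : ℝ))
      atTop (nhds 0) :=
    (tendsto_natCast_atTop_atTop.comp hq).const_div_atTop _
  refine tendsto_of_tendsto_of_dist hmain (squeeze_zero (fun _ => dist_nonneg) (fun k => ?_) herr)
  have hper := hℓs k
  rw [Real.convs_eq_convergent] at hper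
  set r := θ.convergent k with hr
  have h1 := hper.abs_sub_le_of_periodic (one_le_mechWord ha hab _ _) r.den_pos
    fun n _ => mechWord_rat_periodic a b r n
  have h2 := abs_log_contQ_sub_le r.den (one_le_mechWord ha hab θ 0)
    (one_le_mechWord ha hab (r : ℝ) 0) (mechWord_le hab θ 0) (mechWord_le hab (r : ℝ) 0)
    fun i hi hi' => mechWord_eq_of_abs_sub_le a b (abs_sub_convergent_le hθ k) hi hi'
  have h3 := div_le_div_of_nonneg_right h2 r.den.cast_nonneg
  rw [← Nat.abs_cast r.den, ← abs_div, Nat.abs_cast, sub_div] at h3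
  rw [Real.dist_eq, add_div, Function.comp_apply, ← hr]
  rw [abs_sub_comm] at h1
  rw [add_comm]
  exact (abs_sub_le _ _ _).trans (add_le_add h3 h1)
end

section
/- Let a, b be distinct positive integers and d_1, d_2, ... be positive integers. Define words over {a,b} by M_{-1} = b, M_0 = a and M_k = M_{k-1}^{d_k} M_{k-2} for k ≥ 1. Then for every k ≥ 2 one has M_k M_{k-1}^{--} = M_{k-1} M_k^{--}, where for a word W of length ≥ 2, W^{--} denotes W with its last two letters removed. Moreover (M_1 M_0)^{--} = a^{d_1} = (M_0 M_1)^{--}. -/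
open Filter Real Matrix

theorem sturmM_ne_nil (a b : ℕ) (d : ℕ → ℕ) : ∀ n, sturmM a b d n ≠ []
  | 0 => by simp [sturmM]
  | 1 => by simp [sturmM]
  | n + 2 => by simp [sturmM, sturmM_ne_nil a b d n]

theorem two_le_length_sturmM (a b : ℕ) (d : ℕ → ℕ) (n : ℕ) (hd : 1 ≤ d (n + 1)) :
    2 ≤ (sturmM a b d (n + 2)).length := by
  have h₀ := List.length_pos_iff.mpr (sturmM_ne_nil a b d n)
  have h₁ := List.length_pos_iff.mpr (sturmM_ne_nil a b d (n + 1))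
  have h₂ := Nat.mul_pos hd h₁
  simp only [sturmM, List.length_append, List.length_flatten, List.map_replicate,
    List.sum_replicate, smul_eq_mul]
  omega

/-- Consecutive standard words commute up to a swap of the last two letters. -/
theorem exists_sturmM_append_comm (a b : ℕ) (d : ℕ → ℕ) (n : ℕ) :
    ∃ (P : List ℕ) (x y : ℕ),
      sturmM a b d (n + 1) ++ sturmM a b d n = P ++ [x, y] ∧
      sturmM a b d n ++ sturmM a b d (n + 1) = P ++ [y, x] := by
  induction n with
  | zero => exact ⟨[], a, b, rfl, rfl⟩
  | succ n ih =>
    obtain ⟨P, x, y, h₁, h₂⟩ := ih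
    refine ⟨(List.replicate (d (n + 1)) (sturmM a b d (n + 1))).flatten ++ P, y, x, ?_, ?_⟩
    · rw [sturmM, List.append_assoc, h₂, List.append_assoc]
    · rw [sturmM, ← List.append_assoc, ← List.flatten_cons, ← List.replicate_succ,
        List.replicate_succ', List.flatten_append, List.flatten_singleton,
        List.append_assoc, h₁, List.append_assoc]

theorem dropLast_dropLast_append {α : Type*} (l l' : List α) (h : 2 ≤ l'.length) :
    (l ++ l').dropLast.dropLast = l ++ l'.dropLast.dropLast := by
  rw [List.dropLast_append_of_ne_nil, List.dropLast_append_of_ne_nil]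
  all_goals
    apply List.ne_nil_of_length_pos
    grind

/-- For the words `M_{-1} = b`, `M_0 = a`,
`M_k = M_{k-1}^{d_k} M_{k-2}` (here `sturmM a b d (k+1) = M_k`), one has
`M_k M_{k-1}^{--} = M_{k-1} M_k^{--}` for all `k ≥ 2`, and
`(M₁ M₀)^{--} = a^{d₁} = (M₀ M₁)^{--}`. -/
theorem stmt18 (a b : ℕ) (ha : 0 < a) (hb : 0 < b) (hab : a ≠ b)
    (d : ℕ → ℕ) (hd : ∀ k, 1 ≤ k → 1 ≤ d k) :
    (∀ k, 2 ≤ k →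
      sturmM a b d (k + 1) ++ (sturmM a b d k).dropLast.dropLast
        = sturmM a b d k ++ (sturmM a b d (k + 1)).dropLast.dropLast) ∧
    (sturmM a b d 2 ++ sturmM a b d 1).dropLast.dropLast = List.replicate (d 1) a ∧
    (sturmM a b d 1 ++ sturmM a b d 2).dropLast.dropLast = List.replicate (d 1) a := by
  refine ⟨fun k hk => ?_, ?_, ?_⟩
  · obtain ⟨n, rfl⟩ := Nat.exists_eq_add_of_le' hk
    obtain ⟨P, x, y, h₁, h₂⟩ := exists_sturmM_append_comm a b d (n + 2)
    rw [← dropLast_dropLast_append _ _ (two_le_length_sturmM a b d n (hd _ (by omega))),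
      ← dropLast_dropLast_append _ _ (two_le_length_sturmM a b d (n + 1) (hd _ (by omega))),
      h₁, h₂, dropLast_dropLast_append _ _ (by simp), dropLast_dropLast_append _ _ (by simp)]
    rfl
  · simp [sturmM]
  · have h : sturmM a b d 1 ++ sturmM a b d 2 = List.replicate (d 1) a ++ [a, b] := by
      simp [sturmM, ← List.cons_append, ← List.replicate_succ, List.replicate_succ']
    simp [h]
end

section
/- Let s be a Sturmian word over {a,b} with slope θ = [0; 1+d_1, d_2, ...], d_1 ≥ 1, and let (M_k) and (q_k) be as defined. Then for every k ≥ 1, any factor of s of length q_k − 1 is a factor of the word M_k (M_k)^{--}. -/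
open Filter Real Matrix

theorem cfQ_pos (d : ℕ → ℕ) : ∀ k, 0 < cfQ d k
  | 0 => by simp [cfQ]
  | 1 => by simp [cfQ]
  | k + 2 => by
    have := cfQ_pos d k
    simp only [cfQ]
    omega

theorem cfQ_le_succ (d : ℕ → ℕ) (hd : ∀ k, 1 ≤ k → 1 ≤ d k) : ∀ k, cfQ d k ≤ cfQ d (k + 1)
  | 0 => by simp [cfQ]
  | k + 1 => by
    have := Nat.le_mul_of_pos_left (cfQ d (k + 1)) (hd (k + 2) (by omega))
    simp only [cfQ]
    omega

theorem two_le_cfQ_succ (d : ℕ → ℕ) (hd : ∀ k, 1 ≤ k → 1 ≤ d k) : ∀ k, 2 ≤ cfQ d (k + 1)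
  | 0 => by
    have := hd 1 le_rfl
    simp only [cfQ]
    omega
  | k + 1 => (two_le_cfQ_succ d hd k).trans (cfQ_le_succ d hd (k + 1))

theorem cfP_mul_cfQ_sub (d : ℕ → ℕ) (k : ℕ) :
    (cfP d (k + 1) : ℤ) * cfQ d k - cfP d k * cfQ d (k + 1) = (-1) ^ k := by
  induction k with
  | zero => simp [cfP, cfQ]
  | succ k ih =>
    simp only [cfP, cfQ] at *
    push_cast
    rw [pow_succ, ← ih]
    ring

theorem isCoprime_cfP_cfQ (d : ℕ → ℕ) (k : ℕ) : IsCoprime (cfP d k : ℤ) (cfQ d k) := by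
  have h := cfP_mul_cfQ_sub d k
  have h1 : ((-1 : ℤ) ^ k) * (-1) ^ k = 1 := by rw [← mul_pow]; simp
  refine ⟨-(-1) ^ k * cfQ d (k + 1), (-1) ^ k * cfP d (k + 1), ?_⟩
  linear_combination (-1) ^ k * h + h1

theorem abs_cross_mul_cfQ_le (d : ℕ → ℕ) (hd : ∀ k, 1 ≤ k → 1 ≤ d k) (k : ℕ) : ∀ j,
    |(cfP d (k + j) : ℤ) * cfQ d k - cfP d k * cfQ d (k + j)| * cfQ d k ≤ cfQ d (k + j)
  | 0 => by simp [mul_comm]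
  | 1 => by
    rw [cfP_mul_cfQ_sub]
    simpa using cfQ_le_succ d hd k
  | j + 2 => by
    have h0 := abs_cross_mul_cfQ_le d hd k j
    have h1 := abs_cross_mul_cfQ_le d hd k (j + 1)
    have hP : cfP d (k + (j + 2)) = d (k + j + 2) * cfP d (k + (j + 1)) + cfP d (k + j) := rfl
    have hQ : cfQ d (k + (j + 2)) = d (k + j + 2) * cfQ d (k + (j + 1)) + cfQ d (k + j) := rfl
    rw [hP, hQ]
    push_cast
    set D : ℤ := (d (k + j + 2) : ℤ) with hD
    have hD0 : 0 ≤ D := by positivity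
    set x := (cfP d (k + (j + 1)) : ℤ) * cfQ d k - cfP d k * cfQ d (k + (j + 1))
    set y := (cfP d (k + j) : ℤ) * cfQ d k - cfP d k * cfQ d (k + j)
    have hxy : (D * cfP d (k + (j + 1)) + cfP d (k + j)) * (cfQ d k : ℤ)
        - cfP d k * (D * cfQ d (k + (j + 1)) + cfQ d (k + j)) = D * x + y := by
      simp only [x, y]; ring
    rw [hxy]
    calc |D * x + y| * (cfQ d k : ℤ) ≤ (D * |x| + |y|) * cfQ d k := by
          gcongr
          exact (abs_add_le _ _).trans_eq (by rw [abs_mul, abs_of_nonneg hD0])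
      _ = D * (|x| * cfQ d k) + |y| * cfQ d k := by ring
      _ ≤ _ := by gcongr

theorem abs_sub_convergent_le_s19 (d : ℕ → ℕ) (hd : ∀ k, 1 ≤ k → 1 ≤ d k) (θ : ℝ)
    (hθd : Tendsto (fun k => (cfP d k : ℝ) / (cfQ d k : ℝ)) atTop (nhds θ)) (k : ℕ) :
    |θ - cfP d k / cfQ d k| ≤ 1 / (cfQ d k : ℝ) ^ 2 := by
  have ht := ((hθd.sub_const ((cfP d k : ℝ) / cfQ d k)).abs)
  refine le_of_tendsto ht ((eventually_ge_atTop k).mono fun n hn => ?_)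
  obtain ⟨j, rfl⟩ := Nat.exists_eq_add_of_le hn
  have h : |(cfP d (k + j) : ℝ) * cfQ d k - cfP d k * cfQ d (k + j)| * cfQ d k
      ≤ cfQ d (k + j) := by exact_mod_cast abs_cross_mul_cfQ_le d hd k j
  have hq : (0 : ℝ) < cfQ d k := by exact_mod_cast cfQ_pos d k
  have hq' : (0 : ℝ) < cfQ d (k + j) := by exact_mod_cast cfQ_pos d (k + j)
  rw [div_sub_div _ _ hq'.ne' hq.ne', abs_div, abs_of_pos (mul_pos hq' hq),
    div_le_div_iff₀ (by positivity) (by positivity)]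
  rw [mul_comm (cfQ d (k + j) : ℝ) (cfP d k)]
  nlinarith [mul_le_mul_of_nonneg_right h hq.le]

/-- A sequence of integers that stays within one unit of a line of slope `θ` agrees, on a window
of length `q`, with the integer parts along a line of slope `p / q`, when `p / q` is close
enough to `θ`. -/
theorem exists_eq_ediv_of_abs_sub_le {θ : ℝ} {p q : ℕ} (hq : 0 < q)
    (hpq : IsCoprime (p : ℤ) q) (hθ : |θ - p / q| ≤ 1 / (q : ℝ) ^ 2) (f : ℕ → ℤ)
    (hf : ∀ m n, (f m : ℝ) - (f n + 1) < ((m : ℝ) - n) * θ) :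
    ∃ t : ℤ, ∀ n < q, f n = (n * p + t) / q := by
  obtain ⟨m, hm, hmax⟩ := Finset.exists_max_image (Finset.range q)
    (fun n : ℕ => (q : ℤ) * f n - n * p) ⟨0, by simpa using hq⟩
  have hqR : (0 : ℝ) < q := by exact_mod_cast hq
  have hqZ : (0 : ℤ) < q := by exact_mod_cast hq
  refine ⟨q * f m - m * p, fun n hn => ?_⟩
  have hle := hmax n (by simpa using hn)
  have hm' : m < q := by simpa using hm
  have key : (q : ℤ) * f m - m * p < q * (f n + 1) - n * p := by
    have hmn : |(m : ℝ) - n| ≤ q - 1 := by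
      have h1 : (m : ℝ) + 1 ≤ q := by exact_mod_cast hm'
      have h2 : (n : ℝ) + 1 ≤ q := by exact_mod_cast hn
      have h3 : (0 : ℝ) ≤ m := by positivity
      have h4 : (0 : ℝ) ≤ n := by positivity
      rw [abs_le]
      constructor <;> linarith
    have herr : ((m : ℝ) - n) * (θ - p / q) * q < 1 := by
      calc ((m : ℝ) - n) * (θ - p / q) * q ≤ |(m : ℝ) - n| * |θ - p / q| * q := by
            rw [← abs_mul]
            exact mul_le_mul_of_nonneg_right (le_abs_self _) hqR.le
        _ ≤ (q - 1) * (1 / (q : ℝ) ^ 2) * q := by gcongr; exact (abs_nonneg _).trans hmn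
        _ < 1 := by
          rw [show ((q : ℝ) - 1) * (1 / (q : ℝ) ^ 2) * q = (q - 1) / q by field_simp,
            div_lt_one hqR]
          linarith
    have hlt : ((q : ℤ) * f m - m * p) - (q * (f n + 1) - n * p) < 1 := by
      have h := mul_lt_mul_of_pos_left (hf m n) hqR
      have hs : ((m : ℝ) - n) * (θ - p / q) * q = q * (((m : ℝ) - n) * θ) - (m - n) * p := by
        field_simp
      have : (q * f m - m * p : ℝ) - (q * (f n + 1) - n * p) < 1 := by
        rw [hs] at herr
        linarith
      exact_mod_cast this
    refine lt_of_le_of_ne (by omega) fun heq => ?_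
    have hdvd : (q : ℤ) ∣ (m - n : ℤ) := by
      refine hpq.symm.dvd_of_dvd_mul_right ⟨f m - (f n + 1), ?_⟩
      linear_combination -heq
    have hmn0 : (m - n : ℤ) = 0 :=
      Int.eq_zero_of_abs_lt_dvd hdvd (by rw [abs_lt]; constructor <;> omega)
    obtain rfl : m = n := by omega
    have := hf m m
    have h' : (q : ℤ) * f m = q * (f m + 1) := by linarith
    have := mul_left_cancel₀ hqZ.ne' h'
    omega
  symm
  rw [Int.ediv_eq_iff_of_pos hqZ]
  constructor <;> linarith

/-- Integer parts along the lines through two Farey neighbours `p / q < p' / q'` agree. -/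
theorem ediv_eq_sub_one_ediv {p q p' q' n : ℤ} (hq : 0 < q) (hq' : 0 < q')
    (h : p' * q - p * q' = 1) (hn : 0 < n) (hn' : n < q + q') :
    n * p / q = (n * p' - 1) / q' := by
  symm
  rw [Int.ediv_eq_iff_of_pos hq']
  have h1 := Int.mul_ediv_add_emod (n * p) q
  have h2 := Int.emod_nonneg (n * p) hq.ne'
  have h3 := Int.emod_lt_of_pos (n * p) hq
  generalize n * p / q = g at *
  generalize n * p % q = r at *
  have e : q * (n * p' - 1 - g * q') = n + q' * r - q := by
    linear_combination n * h - q' * h1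
  constructor
  · by_contra! hc
    nlinarith
  · by_contra! hc
    nlinarith

/-- The lower (`e = 0`) or upper (`e = 1`) periodic word of slope `p / q` over `{a, b}`. -/
def slopeWord (a b : ℕ) (p q e : ℤ) (j : ℕ) : ℕ :=
  if ((j + 2) * p - e) / q - ((j + 1) * p - e) / q = 0 then a else b

theorem slopeWord_add_mul (a b p q : ℕ) (hq : 0 < q) (e : ℤ) (c j : ℕ) :
    slopeWord a b p q e (c * q + j) = slopeWord a b p q e j := by
  have hq' : (q : ℤ) ≠ 0 := by exact_mod_cast hq.ne'
  unfold slopeWord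
  push_cast
  rw [show ((c * q + j + 2) * p - e : ℤ) = ((j + 2) * p - e) + c * p * q by ring,
    show ((c * q + j + 1) * p - e : ℤ) = ((j + 1) * p - e) + c * p * q by ring,
    Int.add_mul_ediv_right _ _ hq', Int.add_mul_ediv_right _ _ hq', add_sub_add_right_eq_sub]

theorem slopeWord_cf_succ (a b : ℕ) (d : ℕ → ℕ) (k j : ℕ)
    (hj : j + 2 < cfQ d k + cfQ d (k + 1)) :
    slopeWord a b (cfP d (k + 1)) (cfQ d (k + 1)) ((k + 1) % 2 : ℕ) j
      = slopeWord a b (cfP d k) (cfQ d k) (k % 2 : ℕ) j := by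
  have h := cfP_mul_cfQ_sub d k
  have hq : (0 : ℤ) < cfQ d k := by exact_mod_cast cfQ_pos d k
  have hq' : (0 : ℤ) < cfQ d (k + 1) := by exact_mod_cast cfQ_pos d (k + 1)
  unfold slopeWord
  rcases Nat.even_or_odd k with hk | hk
  · rw [hk.neg_one_pow] at h
    rw [Nat.even_iff.mp hk, Nat.odd_iff.mp hk.add_one]
    push_cast
    rw [sub_zero, sub_zero, ediv_eq_sub_one_ediv hq hq' h (by omega) (by omega),
      ediv_eq_sub_one_ediv hq hq' h (by omega) (by omega)]
  · rw [hk.neg_one_pow] at h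
    have h' : (cfP d k : ℤ) * cfQ d (k + 1) - cfP d (k + 1) * cfQ d k = 1 := by linarith
    rw [Nat.odd_iff.mp hk, Nat.even_iff.mp hk.add_one]
    push_cast
    rw [sub_zero, sub_zero, ediv_eq_sub_one_ediv hq' hq h' (by omega) (by omega),
      ediv_eq_sub_one_ediv hq' hq h' (by omega) (by omega)]

theorem map_range_mul_of_periodic {α : Type*} (u : ℕ → α) (q : ℕ)
    (hu : ∀ c j, u (c * q + j) = u j) (c : ℕ) :
    (List.range (c * q)).map u = (List.replicate c ((List.range q).map u)).flatten := by
  induction c with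
  | zero => simp
  | succ c ih =>
    rw [add_mul, one_mul, List.range_add, List.map_append, ih, List.replicate_succ',
      List.flatten_append]
    simp [Function.comp_def, hu]

theorem sturmM_succ_eq_map_slopeWord (a b : ℕ) (d : ℕ → ℕ) (hd : ∀ k, 1 ≤ k → 1 ≤ d k) :
    ∀ k, sturmM a b d (k + 1)
      = (List.range (cfQ d k)).map (slopeWord a b (cfP d k) (cfQ d k) (k % 2 : ℕ))
  | 0 => by simp [sturmM, cfQ, cfP, slopeWord]
  | 1 => by
    have hlast : slopeWord a b 1 (1 + d 1) 1 (d 1) = b := by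
      unfold slopeWord
      rw [show (((d 1 : ℕ) : ℤ) + 2) * 1 - 1 = 1 + d 1 by ring,
        Int.ediv_self (by omega), Int.ediv_eq_zero_of_lt (by omega) (by omega)]
      simp
    have hinit : (List.range (d 1)).map (slopeWord a b 1 (1 + d 1) 1)
        = List.replicate (d 1) a := by
      refine List.eq_replicate_iff.mpr ⟨by simp, fun x hx => ?_⟩
      obtain ⟨j, hj, rfl⟩ := List.mem_map.mp hx
      rw [List.mem_range] at hj
      unfold slopeWord
      rw [Int.ediv_eq_zero_of_lt (by omega) (by omega),
        Int.ediv_eq_zero_of_lt (by omega) (by omega)]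
      simp
    simp only [sturmM, cfQ, cfP]
    rw [add_comm 1 (d 1), List.range_succ, List.map_append]
    push_cast
    rw [add_comm (d 1 : ℤ) 1]
    norm_num
    exact ⟨hinit.symm, hlast.symm⟩
  | k + 2 => by
    have hQ : cfQ d (k + 2) = d (k + 2) * cfQ d (k + 1) + cfQ d k := rfl
    have h2 := two_le_cfQ_succ d hd k
    have hstep : ∀ j < cfQ d (k + 2),
        slopeWord a b (cfP d (k + 2)) (cfQ d (k + 2)) ((k + 2) % 2 : ℕ) j
          = slopeWord a b (cfP d (k + 1)) (cfQ d (k + 1)) ((k + 1) % 2 : ℕ) j := by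
      intro j hj
      refine slopeWord_cf_succ a b d (k + 1) j ?_
      change j + 2 < cfQ d (k + 1) + cfQ d (k + 2)
      omega
    rw [List.map_congr_left fun j hj => hstep j (List.mem_range.mp hj), hQ, List.range_add,
      List.map_append, map_range_mul_of_periodic _ _
        (slopeWord_add_mul a b _ _ (cfQ_pos d (k + 1)) _),
      ← sturmM_succ_eq_map_slopeWord a b d hd (k + 1)]
    have hM : sturmM a b d (k + 2 + 1) = (List.replicate (d (k + 2))
      (sturmM a b d (k + 1 + 1))).flatten ++ sturmM a b d (k + 1) := rfl
    rw [hM, sturmM_succ_eq_map_slopeWord a b d hd k, List.map_map]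
    congr 1
    refine List.map_congr_left fun j hj => ?_
    rw [List.mem_range] at hj
    rw [Function.comp_apply, slopeWord_add_mul a b _ _ (cfQ_pos d (k + 1)),
      slopeWord_cf_succ a b d k j (by omega)]

theorem map_range_append_dropLast_of_periodic {α : Type*} (u : ℕ → α) (q : ℕ)
    (hu : ∀ c j, u (c * q + j) = u j) :
    (List.range q).map u ++ ((List.range q).map u).dropLast.dropLast
      = (List.range (q + (q - 2))).map u := by
  rw [List.range_add, List.map_append, List.map_map]
  congr 1
  apply List.ext_getElem
  · simp; omega
  · intro n h1 h2
    have := hu 1 n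
    simp_all

theorem exists_int_seq_of_mechWord (a b : ℕ) (θ ρ : ℝ) (s : ℕ → ℕ)
    (hs : s = mechWord a b θ ρ ∨ s = mechWord' a b θ ρ) :
    ∃ f : ℕ → ℤ, (∀ m n, (f m : ℝ) - (f n + 1) < ((m : ℝ) - n) * θ) ∧
      ∀ n, s (n + 1) = if f (n + 1) - f n = 0 then a else b := by
  rcases hs with rfl | rfl
  · refine ⟨fun n => ⌊(n : ℝ) * θ + ρ⌋, fun m n => ?_, fun n => ?_⟩
    · have h1 := Int.floor_le ((m : ℝ) * θ + ρ)
      have h2 := Int.lt_floor_add_one ((n : ℝ) * θ + ρ)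
      linarith
    · simp [mechWord]
  · refine ⟨fun n => ⌈(n : ℝ) * θ + ρ⌉ - 1, fun m n => ?_, fun n => ?_⟩
    · have h1 := Int.le_ceil ((n : ℝ) * θ + ρ)
      have h2 := Int.ceil_lt_add_one ((m : ℝ) * θ + ρ)
      push_cast
      linarith
    · simp [mechWord']

/-- The integer parts along a line of slope `p / q` read off a shift of `slopeWord`. -/
theorem exists_slopeWord_shift (a b : ℕ) {p q : ℕ} (hq : 0 < q) (hpq : IsCoprime (p : ℤ) q)
    (e t : ℤ) : ∃ m < q, ∀ j : ℕ, slopeWord a b p q e (m + j)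
      = if ((j + 1) * p + t) / (q : ℤ) - (j * p + t) / (q : ℤ) = 0 then a else b := by
  obtain ⟨u, v, huv⟩ := hpq
  have hq' : (0 : ℤ) < q := by exact_mod_cast hq
  set x : ℤ := (t + e) * u - 1 with hx
  have h0 := Int.emod_nonneg x hq'.ne'
  have h1 := Int.emod_lt_of_pos x hq'
  have h2 := Int.mul_ediv_add_emod x q
  obtain ⟨m, hm⟩ := Int.eq_ofNat_of_zero_le h0
  refine ⟨m, by omega, fun j => ?_⟩
  rw [hm] at h2
  have hc : ∀ i : ℤ, (m + i + 1) * p - e = (i * p + t) + (-(t + e) * v - x / q * p) * q := by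
    intro i
    linear_combination p * h2 + (t + e) * huv + p * hx
  unfold slopeWord
  push_cast
  rw [show ((m : ℤ) + j + 2) = m + (j + 1) + 1 by ring, hc, hc,
    Int.add_mul_ediv_right _ _ hq'.ne', Int.add_mul_ediv_right _ _ hq'.ne',
    add_sub_add_right_eq_sub]

/-- fact `fact1`. Let `s` be a Sturmian word over `{a,b}` with slope
`θ = [0; 1+d₁, d₂, …]` (`d₁ ≥ 1`).  Then, for every `k ≥ 1`, any factor of `s` of length
`q_k - 1` is a factor of `M_k (M_k)^{--}`.  (Recall `sturmM a b d (k+1) = M_k` and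
`cfQ d k = q_k`.) -/
theorem stmt19 (a b : ℕ) (ha : 0 < a) (hb : 0 < b) (hab : a ≠ b)
    (d : ℕ → ℕ) (hd : ∀ k, 1 ≤ k → 1 ≤ d k)
    (θ ρ : ℝ) (hθ : Irrational θ) (hρ : ρ ∈ Set.Ico (0 : ℝ) 1)
    (hθd : Tendsto (fun k => (cfP d k : ℝ) / (cfQ d k : ℝ)) atTop (nhds θ))
    (s : ℕ → ℕ) (hs : s = mechWord a b θ ρ ∨ s = mechWord' a b θ ρ)
    (k : ℕ) (hk : 1 ≤ k)
    (M : List ℕ) (hM : IsFactorSeq s M) (hlen : M.length = cfQ d k - 1) :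
    M <:+: (sturmM a b d (k + 1) ++ (sturmM a b d (k + 1)).dropLast.dropLast) := by
  obtain ⟨i, hi⟩ := hM
  obtain ⟨f, hf, hsf⟩ := exists_int_seq_of_mechWord a b θ ρ s hs
  have hq := cfQ_pos d k
  have hpq := isCoprime_cfP_cfQ d k
  obtain ⟨t, ht⟩ := exists_eq_ediv_of_abs_sub_le hq hpq (abs_sub_convergent_le_s19 d hd θ hθd k)
    (fun n => f (i + n)) (fun m n => by simpa using hf (i + m) (i + n))
  obtain ⟨m, hm, hshift⟩ := exists_slopeWord_shift a b hq hpq (k % 2 : ℕ) t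
  rw [sturmM_succ_eq_map_slopeWord a b d hd k,
    map_range_append_dropLast_of_periodic _ _ (slopeWord_add_mul a b _ _ hq _)]
  set L := (List.range (cfQ d k + (cfQ d k - 2))).map
    (slopeWord a b (cfP d k) (cfQ d k) (k % 2 : ℕ)) with hL
  suffices h : M = (L.drop m).take (cfQ d k - 1) by
    rw [h]
    exact (List.take_prefix _ _).isInfix.trans (List.drop_suffix _ _).isInfix
  rw [hi, hlen]
  have hq2 : 2 ≤ cfQ d k := by
    obtain ⟨k, rfl⟩ := Nat.exists_eq_add_of_le' hk
    exact two_le_cfQ_succ d hd k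
  apply List.ext_getElem
  · simp [hL]
    omega
  · intro n h1 h2
    have hn : n < cfQ d k - 1 := by simpa using h1
    have e0 := ht n (by omega)
    have e1 := ht (n + 1) (by omega)
    have hadd : i + (n + 1) = i + n + 1 := by ring
    simp only [hadd, Nat.cast_add, Nat.cast_one] at e0 e1
    simp only [hL, List.getElem_map, List.getElem_range, List.getElem_take, List.getElem_drop]
    rw [hshift, hsf, e0, e1]
end
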